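/- arXiv:2010.00138 — 5 statements merged into one kernel-verified Lean document; each statement's English description precedes it below -/
import Mathlib

section
/- Let d_P and d_D be nonnegative distance functions on V = {0,1,...,n} each satisfying the triangle inequality. Let f : {1,...,n} → {1,...,k} be a loading plan with exactly h nonempty rows, and let (T_P, T_D) be a pair of tours consistent with f, meaning: for each row r, T_P visits the items of f^{-1}(r) in some linear order and T_D visits them in the exact reverse of that order. Then there exists a tour T on V with d_Σ(T) ≤ h·(d_P(T_P) + d_D(T_D)), where d_Σ(i,j) = d_P(i,j) + d_D(j,i). -/
open Finset

/-- A tour on `V = {0,1,...,n}` (`0` is the depot) is encoded by a permutation `σ` of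
`Fin n`: the item visited at position `p+1` is `σ p` (items `1,...,n` are encoded as
`Fin n` and embedded in `V = Fin (n+1)` via `Fin.succ`). `tourSeq σ q` is the vertex
visited at position `q` of the cycle (position `0` is the depot). -/
def tourSeq {n : ℕ} (σ : Equiv.Perm (Fin n)) (q : Fin (n + 1)) : Fin (n + 1) :=
  if h : q = 0 then 0 else (σ (q.pred h)).succ

/-- Value of a tour: the sum of `d` over its `n+1` consecutive ordered pairs. -/
def tourValue {n : ℕ} (d : Fin (n + 1) → Fin (n + 1) → ℚ) (σ : Equiv.Perm (Fin n)) : ℚ :=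
  ∑ q : Fin (n + 1), d (tourSeq σ q) (tourSeq σ (q + 1))

/-- The reverse tour `T⁻`. -/
def revTour {n : ℕ} (σ : Equiv.Perm (Fin n)) : Equiv.Perm (Fin n) :=
  Fin.revPerm.trans σ

/-- Tour `σ` visits item `i` before item `j`. -/
def visitsBefore {n : ℕ} (σ : Equiv.Perm (Fin n)) (i j : Fin n) : Prop :=
  σ.symm i < σ.symm j

/-- A loading plan with `k` rows, each of capacity `c`: every fiber has size at most `c`. -/
def IsLoadingPlan {n : ℕ} (k c : ℕ) (f : Fin n → Fin k) : Prop :=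
  ∀ r : Fin k, (Finset.univ.filter fun i => f i = r).card ≤ c

/-- The pair of tours `(σP, σD)` is consistent with the loading plan `f`: items loaded in
the same row are visited in opposite orders by the two tours. -/
def FeasibleFor {n k : ℕ} (f : Fin n → Fin k) (σP σD : Equiv.Perm (Fin n)) : Prop :=
  ∀ i j : Fin n, i ≠ j → f i = f j → (visitsBefore σP i j ↔ visitsBefore σD j i)

/-- `(σP, σD)` is a feasible pair of pickup and delivery tours for parameters `(k, c)`. -/
def FeasiblePair {n : ℕ} (k c : ℕ) (σP σD : Equiv.Perm (Fin n)) : Prop :=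
  ∃ f : Fin n → Fin k, IsLoadingPlan k c f ∧ FeasibleFor f σP σD

/-- `d_Σ(i,j) = d_P(i,j) + d_D(j,i)`. -/
def dSigma {n : ℕ} (dP dD : Fin (n + 1) → Fin (n + 1) → ℚ) (i j : Fin (n + 1)) : ℚ :=
  dP i j + dD j i

/-- The set of values of tours under distance `d`. -/
def tourValues (n : ℕ) (d : Fin (n + 1) → Fin (n + 1) → ℚ) : Set ℚ :=
  {v | ∃ σ : Equiv.Perm (Fin n), v = tourValue d σ}

/-- The set of values of feasible pairs of pickup and delivery tours. -/
def feasibleValues (n k c : ℕ) (dP dD : Fin (n + 1) → Fin (n + 1) → ℚ) : Set ℚ :=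
  {v | ∃ σP σD : Equiv.Perm (Fin n), FeasiblePair k c σP σD ∧
        v = tourValue dP σP + tourValue dD σD}

/-- Value of the walk `a, l, b`. -/
def walkVal {V : Type} (d : V → V → ℚ) : V → List V → V → ℚ
  | a, [], b => d a b
  | a, x :: l, b => d a x + walkVal d x l b

theorem walkVal_append {V : Type} (d : V → V → ℚ) (l₁ l₂ : List V) (x a b : V) :
    walkVal d a (l₁ ++ x :: l₂) b = walkVal d a l₁ x + walkVal d x l₂ b := by
  induction l₁ generalizing a with
  | nil => simp [walkVal]
  | cons y l ih => simp [walkVal, ih, add_assoc]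

theorem walkVal_tri {V : Type} (d : V → V → ℚ) (tri : ∀ u v w, d u v ≤ d u w + d w v)
    (l : List V) (a b x : V) : walkVal d a l b ≤ d a x + walkVal d x l b := by
  cases l with
  | nil => exact tri _ _ _
  | cons y l => simp only [walkVal]; linarith [tri a y x]

theorem walkVal_sublist {V : Type} (d : V → V → ℚ) (tri : ∀ u v w, d u v ≤ d u w + d w v)
    (l₁ l₂ : List V) (h : l₁.Sublist l₂) (a b : V) : walkVal d a l₁ b ≤ walkVal d a l₂ b := by
  induction h generalizing a with
  | slnil => exact le_rfl
  | cons x _ ih => exact (walkVal_tri d tri _ a b x).trans (by simp only [walkVal]; linarith [ih x])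
  | cons_cons x _ ih => simp only [walkVal]; linarith [ih x]

theorem walkVal_reverse {V : Type} (d : V → V → ℚ) (l : List V) (a b : V) :
    walkVal (fun i j => d j i) a l b = walkVal d b l.reverse a := by
  induction l generalizing a with
  | nil => rfl
  | cons x l ih => rw [List.reverse_cons, walkVal_append, ← ih]; simp only [walkVal]; ring

theorem walkVal_add {V : Type} (d e : V → V → ℚ) (l : List V) (a b : V) :
    walkVal (fun i j => d i j + e i j) a l b = walkVal d a l b + walkVal e a l b := by
  induction l generalizing a with
  | nil => rfl
  | cons x l ih => simp only [walkVal, ih]; ring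

theorem walkVal_flatMap {V R : Type} (d : V → V → ℚ) (tri : ∀ u v w, d u v ≤ d u w + d w v)
    (c : V) (hc : d c c = 0) (g : R → List V) (C : ℚ) (hg : ∀ r, walkVal d c (g r) c ≤ C)
    (rs : List R) : walkVal d c (rs.flatMap g) c ≤ rs.length * C := by
  induction rs with
  | nil => simp [walkVal, hc]
  | cons r rs ih =>
    have h1 : walkVal d c (g r ++ rs.flatMap g) c ≤ walkVal d c (g r ++ c :: rs.flatMap g) c :=
      walkVal_sublist d tri _ _
        ((List.Sublist.refl (g r)).append (List.sublist_cons_self c _)) c c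
    rw [walkVal_append] at h1
    simp only [List.flatMap_cons, List.length_cons]
    push_cast
    linarith [hg r]

theorem walkVal_ofFn {V : Type} (d : V → V → ℚ) (b : V) : ∀ (n : ℕ) (g : Fin n → V) (a : V),
    walkVal d a (List.ofFn g) b =
      ∑ i : Fin n, d ((Fin.cons a g : Fin (n + 1) → V) i.castSucc)
        ((Fin.cons a g : Fin (n + 1) → V) i.succ)
        + d ((Fin.cons a g : Fin (n + 1) → V) (Fin.last n)) b := by
  intro n
  induction n with
  | zero => intro g a; simp [walkVal]
  | succ n ih =>
    intro g a
    have hg : (Fin.cons (g 0) (fun i => g (Fin.succ i)) : Fin (n + 1) → V) = g := by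
      funext i
      refine Fin.cases ?_ (fun j => ?_) i <;> simp
    rw [List.ofFn_succ, walkVal, ih, Fin.sum_univ_succ, hg]
    simp only [← Fin.succ_last, ← Fin.succ_castSucc, Fin.cons_succ, Fin.castSucc_zero,
      Fin.cons_zero, add_assoc]

theorem tourValue_eq {n : ℕ} (d : Fin (n + 1) → Fin (n + 1) → ℚ) (σ : Equiv.Perm (Fin n)) :
    tourValue d σ = walkVal d 0 ((List.ofFn σ).map Fin.succ) 0 := by
  have hs : tourSeq σ = (Fin.cons 0 (fun i => (σ i).succ) : Fin (n + 1) → Fin (n + 1)) := by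
    funext i
    refine Fin.cases ?_ (fun j => ?_) i <;> simp [tourSeq]
  rw [List.map_ofFn, walkVal_ofFn, tourValue, Fin.sum_univ_castSucc, hs]
  simp [Fin.last_add_one, Fin.coeSucc_eq_succ, Function.comp_def]

/-- if `d_P, d_D` are nonnegative and satisfy the triangle inequality,
`f` is a loading plan with exactly `h` nonempty rows, and `(T_P, T_D)` is a pair of tours
consistent with `f`, then there is a tour `T` with
`d_Σ(T) ≤ h · (d_P(T_P) + d_D(T_D))`. -/
theorem stmt4 (n k h : ℕ) (hn : 1 ≤ n)
    (dP dD : Fin (n + 1) → Fin (n + 1) → ℚ)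
    (hPnn : ∀ i j, 0 ≤ dP i j) (hDnn : ∀ i j, 0 ≤ dD i j)
    (hPdiag : ∀ i, dP i i = 0) (hDdiag : ∀ i, dD i i = 0)
    (hPtri : ∀ u v w, dP u v ≤ dP u w + dP w v)
    (hDtri : ∀ u v w, dD u v ≤ dD u w + dD w v)
    (f : Fin n → Fin k)
    (hrows : (Finset.univ.filter fun r : Fin k => ∃ i, f i = r).card = h)
    (TP TD : Equiv.Perm (Fin n)) (hcons : FeasibleFor f TP TD) :
    ∃ T : Equiv.Perm (Fin n),
      tourValue (dSigma dP dD) T ≤ h * (tourValue dP TP + tourValue dD TD) := by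
  classical
  set rs : List (Fin k) := (Finset.univ.filter fun r : Fin k => ∃ i, f i = r).toList with hrs
  have hlen : rs.length = h := by rw [hrs, Finset.length_toList, hrows]
  set g : Fin k → List (Fin n) := fun r => (List.ofFn TP).filter (fun i => f i = r) with hgdef
  have ndP : (List.ofFn TP).Nodup := List.nodup_ofFn.2 TP.injective
  have ndD : (List.ofFn TD).Nodup := List.nodup_ofFn.2 TD.injective
  have hmem : ∀ i, i ∈ rs.flatMap g := by
    intro i
    rw [List.mem_flatMap]
    refine ⟨f i, by simp [hrs], ?_⟩
    simp only [hgdef, List.mem_filter, decide_true, and_true]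
    exact (List.mem_ofFn' _ _).2 ⟨TP.symm i, by simp⟩
  have hnd : (rs.flatMap g).Nodup := by
    rw [List.nodup_flatMap]
    refine ⟨fun r _ => ndP.filter _, ?_⟩
    refine (Finset.nodup_toList _).imp ?_
    intro r s hne i h1 h2
    simp only [hgdef, List.mem_filter, decide_eq_true_eq] at h1 h2
    exact hne (h1.2.symm.trans h2.2)
  have hLn : (rs.flatMap g).length = n := by
    have := List.toFinset_card_of_nodup hnd
    rw [← this]
    have : (rs.flatMap g).toFinset = Finset.univ := by
      ext i; simp only [List.mem_toFinset, Finset.mem_univ, iff_true]; exact hmem i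
    rw [this, Finset.card_univ, Fintype.card_fin]
  obtain ⟨T, hT⟩ : ∃ T : Equiv.Perm (Fin n), List.ofFn T = rs.flatMap g := by
    let φ : Fin n → Fin n := fun i => (rs.flatMap g).get (Fin.cast hLn.symm i)
    have hφ : List.ofFn φ = rs.flatMap g := by
      apply List.ext_get
      · simp [hLn]
      · intro m h1 h2
        simp [φ]
    have hinj : Function.Injective φ := by
      rw [← List.nodup_ofFn, hφ]; exact hnd
    exact ⟨Equiv.ofBijective φ (Finite.injective_iff_bijective.1 hinj), hφ⟩
  have hrev : ∀ r, (g r).reverse = (List.ofFn TD).filter (fun i => f i = r) := by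
    intro r
    have pP : (g r).reverse.Pairwise (fun i j => visitsBefore TD i j) := by
      rw [List.pairwise_reverse]
      have h0 : (g r).Pairwise (fun i j => visitsBefore TP i j) := by
        refine List.Pairwise.filter _ ?_
        rw [List.pairwise_ofFn]
        intro i j hij
        simpa [visitsBefore] using hij
      refine h0.imp_of_mem ?_
      intro i j hi hj hij
      simp only [hgdef, List.mem_filter, decide_eq_true_eq] at hi hj
      refine (hcons i j ?_ (hi.2.trans hj.2.symm)).1 hij
      rintro rfl
      exact lt_irrefl _ hij
    have pD : ((List.ofFn TD).filter (fun i => f i = r)).Pairwise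
        (fun i j => visitsBefore TD i j) := by
      refine List.Pairwise.filter _ ?_
      rw [List.pairwise_ofFn]
      intro i j hij
      simpa [visitsBefore] using hij
    refine List.Perm.eq_of_pairwise ?_ pP pD ?_
    · intro a b _ _ h1 h2
      exact absurd h2 (lt_asymm h1)
    · refine (List.perm_ext_iff_of_nodup (List.nodup_reverse.2 (ndP.filter _)) (ndD.filter _)).2 ?_
      intro i
      have h1 : i ∈ List.ofFn TP := (List.mem_ofFn' _ _).2 ⟨TP.symm i, by simp⟩
      have h2 : i ∈ List.ofFn TD := (List.mem_ofFn' _ _).2 ⟨TD.symm i, by simp⟩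
      simp only [hgdef, List.mem_reverse, List.mem_filter, h1, h2]
  refine ⟨T, ?_⟩
  have e : dSigma dP dD = fun i j => dP i j + (fun i j => dD j i) i j := rfl
  rw [tourValue_eq, tourValue_eq, tourValue_eq, hT, e, walkVal_add, List.map_flatMap, mul_add,
    ← hlen]
  refine add_le_add ?_ ?_
  · refine walkVal_flatMap dP hPtri 0 (hPdiag 0) _ _ (fun r => ?_) rs
    exact walkVal_sublist dP hPtri _ _ (List.filter_sublist.map _) 0 0
  · refine walkVal_flatMap (fun i j => dD j i) (fun u v w => ?_) 0 (hDdiag 0) _ _ (fun r => ?_) rs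
    · have := hDtri v u w
      linarith
    · rw [walkVal_reverse, ← List.map_reverse, hrev]
      exact walkVal_sublist dD hDtri _ _ (List.filter_sublist.map _) 0 0
end

section
/- Let I be a maximization instance of the DTSPMS on V = {0,1,...,n} with parameters (k, c), c ≥ ⌈n/k⌉, and let ρ ∈ (0,1]. Let T_P and T_D be tours with d_P(T_P) ≥ ρ·OPT(I_P) and d_D(T_D) ≥ ρ·OPT(I_D), where OPT(I_P) and OPT(I_D) are the maximum tour values under d_P and d_D. Then (T_P, T_P^-) and (T_D^-, T_D) are feasible pairs, and max{ d_P(T_P) + d_D(T_P^-), d_P(T_D^-) + d_D(T_D) } ≥ (ρ/2)·OPT(I), where OPT(I) is the maximum value over feasible pairs. -/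
open Finset

theorem aux_plan (n k c : ℕ) (hk : 1 ≤ k) (hc : (n + k - 1) / k ≤ c) :
    ∃ f : Fin n → Fin k, IsLoadingPlan k c f := by
  refine ⟨fun i => ⟨i.1 % k, Nat.mod_lt _ hk⟩, fun r => ?_⟩
  rw [← Finset.card_range c]
  apply Finset.card_le_card_of_injOn (fun i : Fin n => i.1 / k)
  · intro i _
    simp only [Finset.coe_range, Set.mem_Iio]
    refine lt_of_lt_of_le ?_ hc
    have h1 : i.1 / k + 1 = (i.1 + k) / k := (Nat.add_div_right _ hk).symm
    have h2 : (i.1 + k) / k ≤ (n + k - 1) / k := Nat.div_le_div_right (by omega)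
    omega
  · intro i hi j hj hij
    simp only [Finset.coe_filter, Finset.mem_univ, true_and, Set.mem_setOf_eq] at hi hj
    have h := congrArg Fin.val (hi.trans hj.symm)
    simp only at h hij
    apply Fin.ext
    rw [← Nat.div_add_mod i.1 k, ← Nat.div_add_mod j.1 k, h, hij]

theorem aux_rev {n : ℕ} (σ : Equiv.Perm (Fin n)) (i j : Fin n) :
    visitsBefore (revTour σ) i j ↔ visitsBefore σ j i := by
  simp [visitsBefore, revTour]

theorem aux_nonneg {n : ℕ} (d : Fin (n + 1) → Fin (n + 1) → ℚ) (h : ∀ i j, 0 ≤ d i j)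
    (σ : Equiv.Perm (Fin n)) : 0 ≤ tourValue d σ :=
  Finset.sum_nonneg fun _ _ => h _ _

/-- maximization. If `T_P`, `T_D` are `ρ`-approximate tours for `d_P`, `d_D`
respectively, then `(T_P, T_P⁻)` and `(T_D⁻, T_D)` are feasible pairs and the better of
the two has value at least `(ρ/2)·OPT(I)`. -/
theorem stmt7 (n k c : ℕ) (hn : 1 ≤ n) (hk : 1 ≤ k) (hc : (n + k - 1) / k ≤ c)
    (dP dD : Fin (n + 1) → Fin (n + 1) → ℚ)
    (hPnn : ∀ i j, 0 ≤ dP i j) (hDnn : ∀ i j, 0 ≤ dD i j)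
    (hPdiag : ∀ i, dP i i = 0) (hDdiag : ∀ i, dD i i = 0)
    (ρ : ℚ) (hρ0 : 0 < ρ) (hρ1 : ρ ≤ 1)
    (optP optD optI : ℚ)
    (hoptP : IsGreatest (tourValues n dP) optP)
    (hoptD : IsGreatest (tourValues n dD) optD)
    (hoptI : IsGreatest (feasibleValues n k c dP dD) optI)
    (TP TD : Equiv.Perm (Fin n))
    (hTP : ρ * optP ≤ tourValue dP TP)
    (hTD : ρ * optD ≤ tourValue dD TD) :
    FeasiblePair k c TP (revTour TP) ∧ FeasiblePair k c (revTour TD) TD ∧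
      ρ / 2 * optI ≤
        max (tourValue dP TP + tourValue dD (revTour TP))
          (tourValue dP (revTour TD) + tourValue dD TD) := by
  obtain ⟨f, hf⟩ := aux_plan n k c hk hc
  refine ⟨⟨f, hf, fun i j _ _ => (aux_rev TP j i).symm⟩,
    ⟨f, hf, fun i j _ _ => aux_rev TD i j⟩, ?_⟩
  obtain ⟨σP, σD, -, hI⟩ := hoptI.1
  have h1 : tourValue dP σP ≤ optP := hoptP.2 ⟨σP, rfl⟩
  have h2 : tourValue dD σD ≤ optD := hoptD.2 ⟨σD, rfl⟩
  have h3 : ρ * optI ≤ ρ * (optP + optD) := mul_le_mul_of_nonneg_left (by linarith) hρ0.le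
  have h4 := aux_nonneg dD hDnn (revTour TP)
  have h5 := aux_nonneg dP hPnn (revTour TD)
  have h6 := le_max_left (tourValue dP TP + tourValue dD (revTour TP))
          (tourValue dP (revTour TD) + tourValue dD TD)
  have h7 := le_max_right (tourValue dP TP + tourValue dD (revTour TP))
          (tourValue dP (revTour TD) + tourValue dD TD)
  linarith
end

section
/- Let 0 ≤ a < b be rationals and let I be a maximization instance of the DTSPMS on V = {0,1,...,n} with parameters (k, c), c ≥ ⌈n/k⌉, in which d_P(i,j) ∈ {a, b} and d_D(i,j) ∈ {a, b} for all distinct i, j. Let ρ ∈ (0,1] and let T_P, T_D be tours with d_P(T_P) ≥ ρ·OPT(I_P) and d_D(T_D) ≥ ρ·OPT(I_D). Then max{ d_P(T_P) + d_D(T_P^-), d_P(T_D^-) + d_D(T_D) } ≥ ((ρ + a/b)/2)·OPT(I), where OPT(I) is the maximum value over feasible pairs and OPT(I_P), OPT(I_D) are the maximum tour values under d_P, d_D. -/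
open Finset

theorem tourSeq_inj' {n : ℕ} (σ : Equiv.Perm (Fin n)) : Function.Injective (tourSeq σ) := by
  intro p q h
  unfold tourSeq at h
  split_ifs at h with h1 h2 h2
  · rw [h1, h2]
  · exact absurd h.symm (Fin.succ_ne_zero _)
  · exact absurd h (Fin.succ_ne_zero _)
  · have h3 := σ.injective (Fin.succ_injective _ h)
    exact Fin.pred_inj.mp h3

theorem tourSeq_ne' {n : ℕ} (hn : 1 ≤ n) (σ : Equiv.Perm (Fin n)) (q : Fin (n + 1)) :
    tourSeq σ q ≠ tourSeq σ (q + 1) := by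
  intro h
  have h1 := tourSeq_inj' σ h
  obtain ⟨m, rfl⟩ : ∃ m, n = m + 1 := ⟨n - 1, by omega⟩
  have h2 : (1 : Fin (m + 1 + 1)) = 0 := by simpa using h1.symm
  exact absurd h2 (by simp)

theorem tourValue_bounds {n : ℕ} (hn : 1 ≤ n) (a b : ℚ) (hab : a < b)
    (d : Fin (n + 1) → Fin (n + 1) → ℚ)
    (hval : ∀ i j, i ≠ j → d i j = a ∨ d i j = b) (σ : Equiv.Perm (Fin n)) :
    ((n : ℚ) + 1) * a ≤ tourValue d σ ∧ tourValue d σ ≤ ((n : ℚ) + 1) * b := by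
  unfold tourValue
  constructor
  · have h := Finset.card_nsmul_le_sum (Finset.univ : Finset (Fin (n + 1)))
      (fun q => d (tourSeq σ q) (tourSeq σ (q + 1))) a (fun q _ => by
        rcases hval _ _ (tourSeq_ne' hn σ q) with h | h <;> simp only [h] <;> linarith)
    simpa using h
  · have h := Finset.sum_le_card_nsmul (Finset.univ : Finset (Fin (n + 1)))
      (fun q => d (tourSeq σ q) (tourSeq σ (q + 1))) b (fun q _ => by
        rcases hval _ _ (tourSeq_ne' hn σ q) with h | h <;> simp only [h] <;> linarith)
    simpa using h

/-- maximization, bivalued distances in `{a, b}` with `0 ≤ a < b`. If `T_P`,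
`T_D` are `ρ`-approximate tours for `d_P`, `d_D`, then the better of the pairs
`(T_P, T_P⁻)` and `(T_D⁻, T_D)` has value at least `((ρ + a/b)/2)·OPT(I)`. -/
theorem stmt8 (n k c : ℕ) (hn : 1 ≤ n) (hk : 1 ≤ k) (hc : (n + k - 1) / k ≤ c)
    (a b : ℚ) (ha : 0 ≤ a) (hab : a < b)
    (dP dD : Fin (n + 1) → Fin (n + 1) → ℚ)
    (hPval : ∀ i j, i ≠ j → dP i j = a ∨ dP i j = b)
    (hDval : ∀ i j, i ≠ j → dD i j = a ∨ dD i j = b)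
    (hPdiag : ∀ i, dP i i = 0) (hDdiag : ∀ i, dD i i = 0)
    (ρ : ℚ) (hρ0 : 0 < ρ) (hρ1 : ρ ≤ 1)
    (optP optD optI : ℚ)
    (hoptP : IsGreatest (tourValues n dP) optP)
    (hoptD : IsGreatest (tourValues n dD) optD)
    (hoptI : IsGreatest (feasibleValues n k c dP dD) optI)
    (TP TD : Equiv.Perm (Fin n))
    (hTP : ρ * optP ≤ tourValue dP TP)
    (hTD : ρ * optD ≤ tourValue dD TD) :
    (ρ + a / b) / 2 * optI ≤
      max (tourValue dP TP + tourValue dD (revTour TP))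
        (tourValue dP (revTour TD) + tourValue dD TD) := by
  obtain ⟨⟨σP, σD, -, hI⟩, -⟩ := hoptI
  have hP : tourValue dP σP ≤ optP := hoptP.2 ⟨σP, rfl⟩
  have hD : tourValue dD σD ≤ optD := hoptD.2 ⟨σD, rfl⟩
  have b1 := (tourValue_bounds hn a b hab dP hPval σP).2
  have b2 := (tourValue_bounds hn a b hab dD hDval σD).2
  have b3 := (tourValue_bounds hn a b hab dP hPval (revTour TD)).1
  have b4 := (tourValue_bounds hn a b hab dD hDval (revTour TP)).1
  have hb : 0 < b := lt_of_le_of_lt ha hab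
  have h1 : ρ * optI ≤ ρ * (optP + optD) :=
    mul_le_mul_of_nonneg_left (by linarith) hρ0.le
  have h2 : a / b * optI ≤ a / b * (2 * (((n : ℚ) + 1) * b)) :=
    mul_le_mul_of_nonneg_left (by linarith) (div_nonneg ha hb.le)
  have h3 : a / b * (2 * (((n : ℚ) + 1) * b)) = 2 * (((n : ℚ) + 1) * a) := by
    field_simp
  have m1 := le_max_left (tourValue dP TP + tourValue dD (revTour TP))
    (tourValue dP (revTour TD) + tourValue dD TD)
  have m2 := le_max_right (tourValue dP TP + tourValue dD (revTour TP))
    (tourValue dP (revTour TD) + tourValue dD TD)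
  have h4 : (ρ + a / b) / 2 * optI = (ρ * optI + a / b * optI) / 2 := by ring
  rw [h4]
  linarith
end

section
/- Let V be a finite set with |V| ≥ 3 and d a symmetric nonnegative distance function on V. (a) If |V| is even, then any maximum-weight perfect matching M on V satisfies d(M) ≥ (1/2)·max{d(T) : T a Hamiltonian cycle on V}, and any minimum-weight perfect matching satisfies d(M) ≤ (1/2)·min{d(T)}. (b) If |V| is odd, then any maximum-weight near-perfect matching M (a matching covering all but one vertex of V) satisfies d(M) ≥ (1/2)(1 − 1/|V|)·max{d(T)}, and any minimum-weight near-perfect matching satisfies d(M) ≤ (1/2)(1 − 1/|V|)·min{d(T)}. -/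
open Finset

/-- The set of weights of Hamiltonian cycles on `V`: a Hamiltonian cycle is encoded as a
permutation of `V` that is a single cycle with full support; its weight is the sum of `d`
over its edges. -/
def hamWeights (V : Type*) [Fintype V] [DecidableEq V] (d : V → V → ℚ) : Set ℚ :=
  {w | ∃ π : Equiv.Perm V, π.IsCycle ∧ π.support = Finset.univ ∧ w = ∑ v, d v (π v)}

/-- The set of weights of perfect matchings on `V`: a perfect matching is encoded as a
fixed-point-free involution `μ`; its weight is half the sum `∑ v, d v (μ v)` (each edge
is counted twice, using symmetry of `d`). -/
def pmWeights (V : Type*) [Fintype V] (d : V → V → ℚ) : Set ℚ :=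
  {w | ∃ μ : Equiv.Perm V, (∀ v, μ (μ v) = v) ∧ (∀ v, μ v ≠ v) ∧
        w = (∑ v, d v (μ v)) / 2}

/-- The set of weights of near-perfect matchings on `V` (covering all but one vertex):
an involution with exactly one fixed point (the fixed point contributes `d v v = 0`). -/
def npmWeights (V : Type*) [Fintype V] (d : V → V → ℚ) : Set ℚ :=
  {w | ∃ μ : Equiv.Perm V, (∀ v, μ (μ v) = v) ∧ (∃! v, μ v = v) ∧
        w = (∑ v, d v (μ v)) / 2}

theorem aux_surj {V : Type*} [Fintype V] [DecidableEq V] (π : Equiv.Perm V)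
    (h1 : π.IsCycle) (h2 : π.support = Finset.univ) (v : V) :
    Function.Bijective (fun i : Fin (Fintype.card V) => (π ^ (i : ℕ)) v) := by
  rw [Fintype.bijective_iff_surjective_and_card]
  refine ⟨?_, by simp⟩
  intro b
  have hc : π.IsCycleOn ((Finset.univ : Finset V) : Set V) := by
    have := h1.isCycleOn
    convert this using 1
    rw [← h2]; ext x; simp
  obtain ⟨k, hk, hkb⟩ := hc.exists_pow_eq (Finset.mem_univ v) (Finset.mem_univ b)
  exact ⟨⟨k, by simpa using hk⟩, hkb⟩

/-- transported involution -/
noncomputable def auxPerm {V : Type*} [Fintype V] [DecidableEq V] (π : Equiv.Perm V)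
    (h1 : π.IsCycle) (h2 : π.support = Finset.univ)
    (σ : Equiv.Perm (Fin (Fintype.card V))) (v : V) : Equiv.Perm V :=
  ((Equiv.ofBijective _ (aux_surj π h1 h2 v)).symm.trans σ).trans
    (Equiv.ofBijective _ (aux_surj π h1 h2 v))

theorem auxPerm_apply {V : Type*} [Fintype V] [DecidableEq V] (π : Equiv.Perm V)
    (h1 : π.IsCycle) (h2 : π.support = Finset.univ)
    (σ : Equiv.Perm (Fin (Fintype.card V))) (v : V) (i : Fin (Fintype.card V)) :
    auxPerm π h1 h2 σ v ((π ^ (i : ℕ)) v) = (π ^ (σ i : ℕ)) v := by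
  have : (π ^ (i : ℕ)) v = Equiv.ofBijective _ (aux_surj π h1 h2 v) i := rfl
  rw [this, auxPerm]
  simp

theorem aux_weight {V : Type*} [Fintype V] [DecidableEq V] (d : V → V → ℚ)
    (π : Equiv.Perm V)
    (h1 : π.IsCycle) (h2 : π.support = Finset.univ)
    (σ : Equiv.Perm (Fin (Fintype.card V))) (v : V) :
    ∑ x, d x (auxPerm π h1 h2 σ v x) =
      ∑ i : Fin (Fintype.card V), d ((π ^ (i : ℕ)) v) ((π ^ (σ i : ℕ)) v) := by
  rw [← Equiv.sum_comp (Equiv.ofBijective _ (aux_surj π h1 h2 v))]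
  refine Finset.sum_congr rfl fun i _ => ?_
  rw [← auxPerm_apply π h1 h2]
  rfl

theorem aux_shift {V : Type*} [Fintype V] (d : V → V → ℚ)
    (π : Equiv.Perm V) (k : ℕ) :
    ∑ v, d ((π ^ k) v) ((π ^ (k + 1)) v) = ∑ v, d v (π v) := by
  rw [← Equiv.sum_comp (π ^ k) (fun v => d v (π v))]
  simp [pow_succ']

theorem aux_total {V : Type*} [Fintype V] [DecidableEq V] (d : V → V → ℚ)
    (hsym : ∀ u v, d u v = d v u) (hdiag : ∀ v, d v v = 0)
    (π : Equiv.Perm V)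
    (h1 : π.IsCycle) (h2 : π.support = Finset.univ)
    (σ : Equiv.Perm (Fin (Fintype.card V)))
    (hσ : ∀ i, σ i = i ∨ (σ i : ℕ) = i + 1 ∨ (i : ℕ) = σ i + 1) :
    ∑ v, (∑ x, d x (auxPerm π h1 h2 σ v x)) / 2 =
      (∑ i, if σ i = i then (0 : ℚ) else 1) * (∑ v, d v (π v)) / 2 := by
  simp_rw [aux_weight]
  rw [← Finset.sum_div, Finset.sum_comm, Finset.sum_mul]
  congr 1
  refine Finset.sum_congr rfl fun i _ => ?_
  by_cases h : σ i = i
  · simp [h, hdiag]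
  · rw [if_neg h, one_mul]
    rcases hσ i with h' | h' | h'
    · exact absurd h' h
    · rw [h']; exact aux_shift d π i
    · rw [h', ← aux_shift d π (σ i)]
      exact Finset.sum_congr rfl fun v _ => hsym _ _

theorem auxPerm_invol {V : Type*} [Fintype V] [DecidableEq V] (π : Equiv.Perm V)
    (h1 : π.IsCycle) (h2 : π.support = Finset.univ)
    (σ : Equiv.Perm (Fin (Fintype.card V))) (hσ : ∀ i, σ (σ i) = i) (v x : V) :
    auxPerm π h1 h2 σ v (auxPerm π h1 h2 σ v x) = x := by
  obtain ⟨i, rfl⟩ := (aux_surj π h1 h2 v).2 x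
  simp only [auxPerm_apply, hσ]

theorem auxPerm_fix {V : Type*} [Fintype V] [DecidableEq V] (π : Equiv.Perm V)
    (h1 : π.IsCycle) (h2 : π.support = Finset.univ)
    (σ : Equiv.Perm (Fin (Fintype.card V))) (v : V) (i : Fin (Fintype.card V)) :
    auxPerm π h1 h2 σ v ((π ^ (i : ℕ)) v) = (π ^ (i : ℕ)) v ↔ σ i = i := by
  rw [auxPerm_apply]
  exact (aux_surj π h1 h2 v).1.eq_iff

theorem even_perm (n : ℕ) (hn : Even n) : ∃ σ : Equiv.Perm (Fin n),
    (∀ i, σ (σ i) = i) ∧ (∀ i, σ i ≠ i) ∧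
    (∀ i, σ i = i ∨ (σ i : ℕ) = i + 1 ∨ (i : ℕ) = σ i + 1) := by
  obtain ⟨m, hm⟩ := hn
  let f : Fin n → Fin n := fun i =>
    ⟨if (i : ℕ) % 2 = 0 then i + 1 else i - 1, by have := i.2; split_ifs <;> omega⟩
  have hf : Function.Involutive f := by
    intro i; ext; simp only [f]; split_ifs <;> omega
  refine ⟨hf.toPerm f, hf, ?_, ?_⟩
  · intro i h
    have := congrArg Fin.val h
    simp only [f, Function.Involutive.coe_toPerm] at this
    split_ifs at this <;> omega
  · intro i
    simp only [f, Function.Involutive.coe_toPerm, Fin.ext_iff]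
    split_ifs <;> omega

theorem odd_perm (n : ℕ) (hn : Odd n) : ∃ σ : Equiv.Perm (Fin n),
    (∀ i, σ (σ i) = i) ∧ (∀ i, σ i = i ↔ (i : ℕ) = 0) ∧
    (∀ i, σ i = i ∨ (σ i : ℕ) = i + 1 ∨ (i : ℕ) = σ i + 1) := by
  obtain ⟨m, hm⟩ := hn
  let f : Fin n → Fin n := fun i =>
    ⟨if (i : ℕ) % 2 = 0 then i - 1 else i + 1, by have := i.2; split_ifs <;> omega⟩
  have hf : Function.Involutive f := by
    intro i; ext; simp only [f]; split_ifs <;> omega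
  refine ⟨hf.toPerm f, hf, ?_, ?_⟩
  · intro i
    simp only [f, Function.Involutive.coe_toPerm, Fin.ext_iff]
    split_ifs <;> omega
  · intro i
    simp only [f, Function.Involutive.coe_toPerm, Fin.ext_iff]
    split_ifs <;> omega

theorem even_main {V : Type*} [Fintype V] [DecidableEq V] (d : V → V → ℚ)
    (hsym : ∀ u v, d u v = d v u) (hdiag : ∀ v, d v v = 0)
    (hn : Even (Fintype.card V)) (w : ℚ) (hw : w ∈ hamWeights V d) :
    ∃ g : V → ℚ, (∀ v, g v ∈ pmWeights V d) ∧ ∑ v, g v = Fintype.card V * w / 2 := by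
  obtain ⟨π, h1, h2, rfl⟩ := hw
  obtain ⟨σ, hs, hfix, hadj⟩ := even_perm _ hn
  refine ⟨fun v => (∑ x, d x (auxPerm π h1 h2 σ v x)) / 2, fun v => ?_, ?_⟩
  · refine ⟨auxPerm π h1 h2 σ v, auxPerm_invol π h1 h2 σ hs v, fun x => ?_, rfl⟩
    obtain ⟨i, rfl⟩ := (aux_surj π h1 h2 v).2 x
    exact fun h => hfix i ((auxPerm_fix π h1 h2 σ v i).1 h)
  · rw [aux_total d hsym hdiag π h1 h2 σ hadj]
    simp [hfix]

theorem odd_main {V : Type*} [Fintype V] [DecidableEq V] (d : V → V → ℚ)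
    (hsym : ∀ u v, d u v = d v u) (hdiag : ∀ v, d v v = 0)
    (hn : Odd (Fintype.card V)) (w : ℚ) (hw : w ∈ hamWeights V d) :
    ∃ g : V → ℚ, (∀ v, g v ∈ npmWeights V d) ∧
      ∑ v, g v = ((Fintype.card V : ℚ) - 1) * w / 2 := by
  obtain ⟨π, h1, h2, rfl⟩ := hw
  obtain ⟨σ, hs, hfix, hadj⟩ := odd_perm _ hn
  have hpos : 0 < Fintype.card V := hn.pos
  refine ⟨fun v => (∑ x, d x (auxPerm π h1 h2 σ v x)) / 2, fun v => ?_, ?_⟩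
  · refine ⟨auxPerm π h1 h2 σ v, auxPerm_invol π h1 h2 σ hs v, ?_, rfl⟩
    refine ⟨(π ^ ((⟨0, hpos⟩ : Fin (Fintype.card V)) : ℕ)) v,
      (auxPerm_fix π h1 h2 σ v _).2 ((hfix _).2 rfl), ?_⟩
    intro x hx
    obtain ⟨i, rfl⟩ := (aux_surj π h1 h2 v).2 x
    have := (hfix i).1 ((auxPerm_fix π h1 h2 σ v i).1 hx)
    simp [this]
  · rw [aux_total d hsym hdiag π h1 h2 σ hadj]
    congr 2
    have : ∀ i, (if σ i = i then (0 : ℚ) else 1) =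
        1 - if i = (⟨0, hpos⟩ : Fin (Fintype.card V)) then 1 else 0 := by
      intro i
      have : σ i = i ↔ i = (⟨0, hpos⟩ : Fin (Fintype.card V)) := by
        rw [hfix, Fin.ext_iff]
      by_cases h : i = (⟨0, hpos⟩ : Fin (Fintype.card V)) 
      · rw [if_pos (this.2 h), if_pos h]; simp
      · rw [if_neg (fun h' => h (this.1 h')), if_neg h]; simp
    simp_rw [this]
    rw [Finset.sum_sub_distrib]
    simp

/-- (a) if `|V|` is even, a maximum-weight perfect matching has weight at
least half the maximum Hamiltonian cycle weight, and a minimum-weight perfect matching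
has weight at most half the minimum Hamiltonian cycle weight; (b) if `|V|` is odd, the
same holds for near-perfect matchings with factor `(1/2)(1 − 1/|V|)`. -/
theorem stmt11 (V : Type*) [Fintype V] [DecidableEq V]
    (hV : 3 ≤ Fintype.card V)
    (d : V → V → ℚ) (hsym : ∀ u v, d u v = d v u)
    (hnn : ∀ u v, 0 ≤ d u v) (hdiag : ∀ v, d v v = 0) :
    (Even (Fintype.card V) →
      (∀ wM wT : ℚ, IsGreatest (pmWeights V d) wM → IsGreatest (hamWeights V d) wT →
        wT / 2 ≤ wM) ∧
      (∀ wM wT : ℚ, IsLeast (pmWeights V d) wM → IsLeast (hamWeights V d) wT →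
        wM ≤ wT / 2)) ∧
    (Odd (Fintype.card V) →
      (∀ wM wT : ℚ, IsGreatest (npmWeights V d) wM → IsGreatest (hamWeights V d) wT →
        1 / 2 * (1 - 1 / (Fintype.card V : ℚ)) * wT ≤ wM) ∧
      (∀ wM wT : ℚ, IsLeast (npmWeights V d) wM → IsLeast (hamWeights V d) wT →
        wM ≤ 1 / 2 * (1 - 1 / (Fintype.card V : ℚ)) * wT)) := by
  have hc : (0 : ℚ) < Fintype.card V := by
    have : 0 < Fintype.card V := by omega
    exact_mod_cast this
  refine ⟨fun hn => ⟨fun wM wT hM hT => ?_, fun wM wT hM hT => ?_⟩,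
    fun hn => ⟨fun wM wT hM hT => ?_, fun wM wT hM hT => ?_⟩⟩
  · obtain ⟨g, hg, hs⟩ := even_main d hsym hdiag hn wT hT.1
    have := Finset.sum_le_sum (fun v (_ : v ∈ Finset.univ) => hM.2 (hg v))
    rw [hs, Finset.sum_const, Finset.card_univ, nsmul_eq_mul, mul_div_assoc] at this
    exact le_of_mul_le_mul_left this hc
  · obtain ⟨g, hg, hs⟩ := even_main d hsym hdiag hn wT hT.1
    have := Finset.sum_le_sum (fun v (_ : v ∈ Finset.univ) => hM.2 (hg v))
    rw [hs, Finset.sum_const, Finset.card_univ, nsmul_eq_mul, mul_div_assoc] at this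
    exact le_of_mul_le_mul_left this hc
  · obtain ⟨g, hg, hs⟩ := odd_main d hsym hdiag hn wT hT.1
    have := Finset.sum_le_sum (fun v (_ : v ∈ Finset.univ) => hM.2 (hg v))
    rw [hs, Finset.sum_const, Finset.card_univ, nsmul_eq_mul] at this
    refine le_of_mul_le_mul_left (le_of_eq_of_le ?_ this) hc
    field_simp
  · obtain ⟨g, hg, hs⟩ := odd_main d hsym hdiag hn wT hT.1
    have := Finset.sum_le_sum (fun v (_ : v ∈ Finset.univ) => hM.2 (hg v))
    rw [hs, Finset.sum_const, Finset.card_univ, nsmul_eq_mul] at this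
    refine le_of_mul_le_mul_left (le_of_le_of_eq this ?_) hc
    field_simp
end

section
/- Let V = {0,1,...,n} with n ≥ 2, and let M_P and M_D each be a perfect matching on V (if |V| = n+1 is even) or a near-perfect matching on V (if |V| is odd). Then there exist a loading plan f : {1,...,n} → {1,2} with both fibers of size at most ⌈n/2⌉ and a pair (T_P, T_D) of tours that is a feasible pair of pickup and delivery tours with respect to f, such that every edge of M_P is an edge of the Hamiltonian cycle T_P and every edge of M_D is an edge of the Hamiltonian cycle T_D. -/
open Finset

/-- A matching on `V = Fin (n+1)` encoded as an involution; `μ v ≠ v` means the edge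
`{v, μ v}` belongs to the matching. -/
def IsInvolution {m : ℕ} (μ : Equiv.Perm (Fin m)) : Prop := ∀ v, μ (μ v) = v

/-- Every edge of the matching `μ` is an edge of the tour `σ`. -/
def MatchingInTour {n : ℕ} (μ : Equiv.Perm (Fin (n + 1))) (σ : Equiv.Perm (Fin n)) : Prop :=
  ∀ v : Fin (n + 1), μ v ≠ v → ∃ q : Fin (n + 1),
    (tourSeq σ q = v ∧ tourSeq σ (q + 1) = μ v) ∨
    (tourSeq σ q = μ v ∧ tourSeq σ (q + 1) = v)

/-- Adjacent somewhere in the list. -/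
def AdjIn {α : Type*} (L : List α) (u v : α) : Prop := [u, v] <:+: L ∨ [v, u] <:+: L

theorem AdjIn.mem_right {α : Type*} {L : List α} {u v : α} (h : AdjIn L u v) : v ∈ L := by
  rcases h with h | h <;> exact h.subset (by simp)

theorem AdjIn.append_right {α : Type*} {L : List α} {u v : α} (h : AdjIn L u v) (K : List α) :
    AdjIn (L ++ K) u v := by
  rcases h with h | h
  · exact Or.inl (h.trans (List.infix_append' [] L K))
  · exact Or.inr (h.trans (List.infix_append' [] L K))

theorem AdjIn.append_left {α : Type*} {L : List α} {u v : α} (h : AdjIn L u v) (K : List α) :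
    AdjIn (K ++ L) u v := by
  rcases h with h | h
  · exact Or.inl (h.trans (List.suffix_append K L).isInfix)
  · exact Or.inr (h.trans (List.suffix_append K L).isInfix)

theorem AdjIn.symm {α : Type*} {L : List α} {u v : α} (h : AdjIn L u v) : AdjIn L v u :=
  Or.symm h

/-- The invariant of the construction. -/
structure LInv {α : Type*} (z : α → Bool) (o : α) (p d : α → α)
    (P D E : List (α × Bool)) : Prop where
  nd : (P.map Prod.fst).Nodup
  perm : (D ++ E).Perm P
  adjP : ∀ v ∈ P.map Prod.fst, AdjIn (P.map Prod.fst) v (p v)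
  adjD : ∀ v ∈ D.map Prod.fst, AdjIn (D.map Prod.fst) v (d v)
  tt : P.filter (fun e => e.2) = (D ++ E).filter (fun e => e.2)
  ff : P.filter (fun e => !e.2 && !z e.1) = (D ++ E).filter (fun e => !e.2 && !z e.1)
  bal : (P.filter (fun e => e.2)).length = (P.filter (fun e => !e.2)).length
  zF : ∀ e ∈ P, z e.1 = true → e.2 = false
  hP : P.head? = some (o, true)
  hD : (D ++ E).head? = some (o, true)

theorem LInv.symm {α : Type*} {z : α → Bool} {o : α} {p d : α → α}
    {P D : List (α × Bool)} (h : LInv z o p d P D []) : LInv z o d p D P [] := by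
  have hp : D.Perm P := by simpa using h.perm
  refine ⟨(hp.map _).nodup_iff.2 h.nd, by simpa using hp.symm, h.adjD, h.adjP, ?_, ?_, ?_, ?_, ?_, ?_⟩
  · simpa using h.tt.symm
  · simpa using h.ff.symm
  · rw [(hp.filter _).length_eq, (hp.filter _).length_eq, h.bal]
  · exact fun e he => h.zF e (hp.subset he)
  · simpa using h.hD
  · simpa using h.hP

theorem adj_app {α : Type*} {d : α → α} {D K : List (α × Bool)}
    (h1 : ∀ v ∈ D.map Prod.fst, AdjIn (D.map Prod.fst) v (d v))
    (h2 : ∀ v ∈ K.map Prod.fst, AdjIn (K.map Prod.fst) v (d v)) :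
    ∀ v ∈ (D ++ K).map Prod.fst, AdjIn ((D ++ K).map Prod.fst) v (d v) := by
  intro v hv
  rw [List.map_append] at hv ⊢
  rcases List.mem_append.1 hv with h | h
  · exact (h1 v h).append_right _
  · exact (h2 v h).append_left _

theorem adj_two {α : Type*} {d : α → α} (hd : ∀ v, d (d v) = v) (x : α) (b c : Bool) :
    ∀ v ∈ [(x, b), (d x, c)].map Prod.fst,
      AdjIn ([(x, b), (d x, c)].map Prod.fst) v (d v) := by
  intro v hv
  simp only [List.map_cons, List.map_nil, List.mem_cons, List.not_mem_nil, or_false] at hv ⊢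
  rcases hv with rfl | rfl
  · exact Or.inl (List.infix_refl _)
  · rw [hd]; exact Or.inr (List.infix_refl _)

theorem LInv.close {α : Type*} {z : α → Bool} {o : α} {p d : α → α}
    (hd : ∀ v, d (d v) = v)
    {P D : List (α × Bool)} {x y : α} (h : LInv z o p d P D [(x, true), (y, false)])
    (hxy : d x = y) : LInv z o p d P (D ++ [(x, true), (y, false)]) [] := by
  subst hxy
  refine ⟨h.nd, by simpa using h.perm, h.adjP, adj_app h.adjD (adj_two hd x _ _), ?_, ?_, h.bal,
    h.zF, h.hP, by simpa using h.hD⟩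
  · simpa using h.tt
  · simpa using h.ff

theorem head_app {α : Type*} {D K : List α} {a : α} (h : D.head? = some a) :
    (D ++ K).head? = some a := by
  cases D <;> simp_all

theorem LInv.start {α : Type*} {z : α → Bool} {o : α} {p d : α → α}
    (hd : ∀ v, d (d v) = v) (hd' : ∀ v, d v ≠ v)
    {P D : List (α × Bool)} (h : LInv z o p d P D []) {v : α} (hv : v ∉ P.map Prod.fst)
    (hz : z v = false) :
    LInv z o d p (D ++ [(v, true), (d v, false)]) P [(v, true), (d v, false)] := by
  have hp : D.Perm P := by simpa using h.perm
  have hpm := hp.map Prod.fst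
  have hvD : v ∉ D.map Prod.fst := fun h' => hv (hpm.subset h')
  have hdvD : d v ∉ D.map Prod.fst := fun h' => hvD (by
    have := (h.adjD _ h').mem_right
    rwa [hd] at this)
  have hnD : (D.map Prod.fst).Nodup := hpm.nodup_iff.2 h.nd
  refine ⟨?_, hp.symm.append_right _, adj_app h.adjD (adj_two hd v _ _), h.adjP, ?_, ?_, ?_, ?_,
    ?_, ?_⟩
  · rw [List.map_append, List.nodup_append']
    refine ⟨hnD, by simpa using (hd' v).symm, ?_⟩
    intro a ha hb
    simp only [List.map_cons, List.map_nil, List.mem_cons, List.not_mem_nil, or_false] at hb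
    rcases hb with rfl | rfl
    · exact hvD ha
    · exact hdvD ha
  · have := h.tt
    rw [List.append_nil] at this
    rw [List.filter_append, List.filter_append, this]
  · have := h.ff
    rw [List.append_nil] at this
    rw [List.filter_append, List.filter_append, this]
  · have := h.symm.bal
    simp [List.filter_append, this]
  · intro e he
    rcases List.mem_append.1 he with he | he
    · exact h.symm.zF e he
    · simp only [List.mem_cons, List.not_mem_nil, or_false] at he
      rcases he with rfl | rfl
      · simp [hz]
      · simp
  · exact head_app h.symm.hP
  · exact head_app h.hP

theorem LInv.step {α : Type*} [DecidableEq α] {z : α → Bool} {o : α} {p d : α → α}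
    (hd : ∀ v, d (d v) = v) (hd' : ∀ v, d v ≠ v)
    (hz : ∀ u v, z u = true → z v = true → u = v)
    {P D : List (α × Bool)} {x y : α} (h : LInv z o p d P D [(x, true), (y, false)])
    (hxy : d x ≠ y) : ∃ P' x' y', P'.length = P.length + 2 ∧
      LInv z o d p P' P [(x', true), (y', false)] := by
  have hpm := h.perm.map Prod.fst
  have hnd := hpm.nodup_iff.2 h.nd
  rw [List.map_append, List.nodup_append'] at hnd
  obtain ⟨hnD, hnE, hdis⟩ := hnd
  have hxD : x ∉ D.map Prod.fst := fun h' => hdis h' (by simp)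
  have hyD : y ∉ D.map Prod.fst := fun h' => hdis h' (by simp)
  have hxD' : d x ∉ D.map Prod.fst := fun h' => hxD (by
    have := (h.adjD _ h').mem_right
    rwa [hd] at this)
  have hyD' : d y ∉ D.map Prod.fst := fun h' => hyD (by
    have := (h.adjD _ h').mem_right
    rwa [hd] at this)
  have hne : x ≠ y := by simpa using hnE
  have hne' : d x ≠ d y := fun e => hne (by rw [← hd x, e, hd])
  have hyx : d y ≠ x := fun e => hxy (by rw [← e, hd])
  have hlen : D.length + 2 = P.length := by simpa using h.perm.length_eq
  have hbal : (D.filter (fun e => e.2)).length = (D.filter (fun e => !e.2)).length := by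
    have := h.bal
    rw [← (h.perm.filter _).length_eq, ← (h.perm.filter _).length_eq] at this
    simpa [List.filter_append] using this
  have hzD : ∀ e ∈ D, z e.1 = true → e.2 = false := fun e he =>
    h.zF e (h.perm.subset (List.mem_append_left _ he))
  have hzx : z x = false := by
    by_contra hc
    have := h.zF (x, true) (h.perm.subset (by simp)) (by simpa using hc)
    simp at this
  have hnod : ∀ b c : Bool, ((D ++ ([(x, true), (d x, b)] ++ [(y, false), (d y, c)])).map
      Prod.fst).Nodup := by
    intro b c
    rw [List.map_append, List.nodup_append']
    refine ⟨hnD, ?_, ?_⟩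
    · simp [hne, hne', hxy, hyx.symm, (hd' x).symm, (hd' y).symm]
    · intro a ha hb
      simp only [List.map_append, List.map_cons, List.map_nil, List.mem_cons, List.not_mem_nil,
        or_false, List.cons_append, List.nil_append] at hb
      rcases hb with rfl | rfl | rfl | rfl <;> contradiction
  have hadj : ∀ b c : Bool, ∀ v ∈ (D ++ ([(x, true), (d x, b)] ++ [(y, false), (d y, c)])).map
      Prod.fst, AdjIn ((D ++ ([(x, true), (d x, b)] ++ [(y, false), (d y, c)])).map
      Prod.fst) v (d v) := fun b c =>
    adj_app h.adjD (adj_app (adj_two hd x _ _) (adj_two hd y _ _))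
  have hhead : ∀ b c : Bool, (D ++ ([(x, true), (d x, b)] ++ [(y, false), (d y, c)])).head?
      = some (o, true) := by
    intro b c
    have := h.hD
    cases D <;> simp_all
  have hcount : ∀ e, D.count e + List.count e [(x, true), (y, false)] = P.count e := by
    intro e
    rw [← h.perm.count_eq, List.count_append]
  have htt := h.tt
  have hff := h.ff
  by_cases hzz : z (d x) = true
  · have hzy : z (d y) = false := by
      by_contra hc
      exact hne' (hz _ _ hzz (by simpa using hc))
    refine ⟨D ++ ([(x, true), (d x, false)] ++ [(y, false), (d y, true)]), d y, d x, ?_,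
      hnod _ _, ?_, hadj _ _, h.adjP, ?_, ?_, ?_, ?_, hhead _ _, head_app h.hP⟩
    · simp; omega
    · rw [List.perm_iff_count]
      intro e
      have := hcount e
      simp only [List.count_append, List.count_cons, List.count_nil] at this ⊢
      omega
    · rw [List.filter_append P, htt]
      simp [List.filter_append]
    · rw [List.filter_append P, hff]
      simp [List.filter_append, hzz, List.filter_cons]
    · simp [List.filter_append, hbal]
    · intro e he
      rcases List.mem_append.1 he with he | he
      · exact hzD e he
      · simp only [List.mem_cons, List.not_mem_nil, or_false, List.cons_append,
          List.nil_append] at he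
        rcases he with rfl | rfl | rfl | rfl <;> simp_all
  · refine ⟨D ++ ([(x, true), (d x, true)] ++ [(y, false), (d y, false)]), d x, d y, ?_,
      hnod _ _, ?_, hadj _ _, h.adjP, ?_, ?_, ?_, ?_, hhead _ _, head_app h.hP⟩
    · simp; omega
    · rw [List.perm_iff_count]
      intro e
      have := hcount e
      simp only [List.count_append, List.count_cons, List.count_nil] at this ⊢
      omega
    · rw [List.filter_append P, htt]
      simp [List.filter_append]
    · rw [List.filter_append P, hff]
      simp [List.filter_append, List.filter_cons]
      split_ifs <;> simp
    · simp [List.filter_append, hbal]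
    · intro e he
      rcases List.mem_append.1 he with he | he
      · exact hzD e he
      · simp only [List.mem_cons, List.not_mem_nil, or_false, List.cons_append,
          List.nil_append] at he
        rcases he with rfl | rfl | rfl | rfl <;> simp_all

theorem LInv.finish {α : Type*} [DecidableEq α] [Fintype α] {z : α → Bool} {o : α}
    (hz : ∀ u v, z u = true → z v = true → u = v) (k : ℕ) :
    ∀ (p d : α → α) (_ : ∀ v, d (d v) = v) (_ : ∀ v, d v ≠ v)
    (_ : ∀ v, p (p v) = v) (_ : ∀ v, p v ≠ v)
    (P D : List (α × Bool)) (x y : α) (_ : LInv z o p d P D [(x, true), (y, false)])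
    (_ : Fintype.card α < P.length + k),
    ∃ P' D', LInv z o p d P' D' [] ∧ ∀ v, v ∈ P'.map Prod.fst := by
  induction k with
  | zero =>
    intro p d _ _ _ _ P D x y h hk
    have := h.nd.length_le_card
    simp at this
    omega
  | succ k ih =>
    intro p d hd hd' hp hp' P D x y h hk
    have key : ∃ P' D', LInv z o d p P' D' [] ∧ ∀ v, v ∈ P'.map Prod.fst := by
      by_cases hxy : d x = y
      · have h' := h.close hd hxy
        by_cases hall : ∀ v, v ∈ P.map Prod.fst
        · refine ⟨_, _, h'.symm, fun v => ?_⟩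
          have := (h'.perm.map Prod.fst).symm.subset (hall v)
          simpa using this
        · push Not at hall
          obtain ⟨v, hv⟩ := hall
          have hvz : ∃ v, v ∉ P.map Prod.fst ∧ z v = false := by
            by_cases hzv : z v = true
            · refine ⟨p v, fun hm => hv ?_, ?_⟩
              · have := (h.adjP _ hm).mem_right
                rwa [hp] at this
              · by_contra hc
                exact hp' v (hz _ _ (by simpa using hc) hzv)
            · exact ⟨v, hv, by simpa using hzv⟩
          obtain ⟨v, hv, hzv⟩ := hvz
          refine ih d p hp hp' hd hd' _ _ _ _ (h'.start hd hd' hv hzv) ?_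
          have := h.perm.length_eq
          simp at this ⊢
          omega
      · obtain ⟨P', x', y', hl, h'⟩ := h.step hd hd' hz hxy
        exact ih d p hp hp' hd hd' _ _ _ _ h' (by omega)
    obtain ⟨P', D', h', hall⟩ := key
    refine ⟨D', P', h'.symm, fun v => ?_⟩
    have := (h'.perm.map Prod.fst).symm.subset (hall v)
    simpa using this

theorem exists_LInv {α : Type*} [DecidableEq α] [Fintype α] {z : α → Bool} {o : α}
    (hz : ∀ u v, z u = true → z v = true → u = v) (ho : z o = false)
    (p d : α → α) (hd : ∀ v, d (d v) = v) (hd' : ∀ v, d v ≠ v)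
    (hp : ∀ v, p (p v) = v) (hp' : ∀ v, p v ≠ v) :
    ∃ P' D', LInv z o p d P' D' [] ∧ ∀ v, v ∈ P'.map Prod.fst := by
  refine LInv.finish hz (Fintype.card α + 1) p d hd hd' hp hp' [(o, true), (p o, false)] []
    o (p o) ?_ (by omega)
  refine ⟨?_, List.Perm.refl _, adj_two hp o _ _, by simp, rfl, rfl, by simp, ?_, rfl, rfl⟩
  · simpa using (hp' o).symm
  · simp [ho]

theorem pairs_to_fun {α : Type*} [DecidableEq α] [Fintype α] {z : α → Bool} {o : α}
    (hz : ∀ u v, z u = true → z v = true → u = v) (ho : z o = false)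
    (p d : α → α) (hd : ∀ v, d (d v) = v) (hd' : ∀ v, d v ≠ v)
    (hp : ∀ v, p (p v) = v) (hp' : ∀ v, p v ≠ v) :
    ∃ (c : α → Bool) (L K : List α), L.Nodup ∧ K.Nodup ∧ (∀ v, v ∈ L) ∧ (∀ v, v ∈ K) ∧
      L.head? = some o ∧ K.head? = some o ∧ L.filter c = K.filter c ∧
      L.filter (fun v => !c v && !z v) = K.filter (fun v => !c v && !z v) ∧
      (L.filter c).length = (L.filter (fun v => !c v)).length ∧ (∀ v, z v = true → c v = false) ∧
      c o = true ∧ (∀ v, AdjIn L v (p v)) ∧ (∀ v, AdjIn K v (d v)) := by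
  obtain ⟨P, D, h, hall⟩ := exists_LInv hz ho p d hd hd' hp hp'
  have hpm : D.Perm P := by simpa using h.perm
  have hpf := hpm.map Prod.fst
  have hallD : ∀ v, v ∈ D.map Prod.fst := fun v => hpf.symm.subset (hall v)
  let c : α → Bool := fun v => decide ((v, true) ∈ P)
  have hc : ∀ e ∈ P, c e.1 = e.2 := by
    rintro ⟨v, b⟩ he
    cases b
    · simp only [c, decide_eq_false_iff_not]
      intro h'
      have := List.inj_on_of_nodup_map h.nd he h' rfl
      simp at this
    · simpa [c] using he
  have hf : ∀ (g : Bool → α → Bool) (Q : List (α × Bool)), (∀ e ∈ Q, e ∈ P) →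
      (Q.map Prod.fst).filter (fun v => g (c v) v) =
        (Q.filter (fun e => g e.2 e.1)).map Prod.fst := by
    intro g Q hQ
    rw [List.filter_map]
    congr 1
    apply List.filter_congr
    intro e he
    simp [hc e (hQ e he)]
  have hDP : ∀ e ∈ D, e ∈ P := fun e he => hpm.subset he
  have hPP : ∀ e ∈ P, e ∈ P := fun e he => he
  refine ⟨c, P.map Prod.fst, D.map Prod.fst, h.nd, hpf.nodup_iff.2 h.nd, hall, hallD, ?_, ?_,
    ?_, ?_, ?_, ?_, ?_, fun v => h.adjP v (hall v), fun v => h.adjD v (hallD v)⟩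
  · simp [h.hP]
  · have := h.hD
    simp at this
    simp [this]
  · have h1 := hf (fun b _ => b) P hPP
    have h2 := hf (fun b _ => b) D hDP
    have h3 := h.tt
    simp only [List.append_nil] at h1 h2 h3
    rw [h1, h2, h3]
  · have h1 := hf (fun b v => !b && !z v) P hPP
    have h2 := hf (fun b v => !b && !z v) D hDP
    have h3 := h.ff
    simp only [List.append_nil] at h1 h2 h3
    rw [h1, h2, h3]
  · have h1 := hf (fun b _ => b) P hPP
    have h2 := hf (fun b _ => !b) P hPP
    rw [h1, h2, List.length_map, List.length_map, h.bal]
  · intro v hv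
    obtain ⟨e, he, rfl⟩ := List.mem_map.1 (hall v)
    rw [hc e he]
    exact h.zF e he hv
  · simpa [c] using List.mem_of_mem_head? h.hP

theorem len_split {α : Type*} (L : List α) (c : α → Bool) :
    (L.filter c).length + (L.filter (fun v => !c v)).length = L.length := by
  induction L with
  | nil => simp
  | cons a l ih => cases h : c a <;> simp [h] <;> omega

/-- Extension of an involution with one fixed point `m` to `Option`. -/
def extInv {β : Type*} [DecidableEq β] (μ : β → β) (m : β) : Option β → Option β
  | none => some m
  | some v => if v = m then none else some (μ v)

theorem extInv_inv {β : Type*} [DecidableEq β] (μ : β → β) (m : β) (h : ∀ v, μ (μ v) = v)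
    (hm : μ m = m) : ∀ v, extInv μ m (extInv μ m v) = v := by
  rintro (_ | v)
  · simp [extInv]
  · by_cases hv : v = m
    · simp [extInv, hv]
    · have : μ v ≠ m := fun e => hv (by rw [← h v, e, hm])
      simp [extInv, hv, this, h]

theorem extInv_ne {β : Type*} [DecidableEq β] (μ : β → β) (m : β)
    (hm : ∀ v, μ v = v → v = m) : ∀ v, extInv μ m v ≠ v := by
  rintro (_ | v)
  · simp [extInv]
  · by_cases hv : v = m
    · simp [extInv, hv]
    · simp only [extInv, hv, if_false]
      intro h
      exact hv (hm v (Option.some.inj h))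

theorem main_lists (n : ℕ) 
    (μP μD : Equiv.Perm (Fin (n + 1)))
    (hPinv : IsInvolution μP) (hDinv : IsInvolution μD)
    (hPperf : Even (n + 1) → ∀ v, μP v ≠ v)
    (hPnear : ¬ Even (n + 1) → ∃! v, μP v = v)
    (hDperf : Even (n + 1) → ∀ v, μD v ≠ v)
    (hDnear : ¬ Even (n + 1) → ∃! v, μD v = v) :
    ∃ (c : Fin (n + 1) → Bool) (L K : List (Fin (n + 1))), L.Nodup ∧ K.Nodup ∧
      (∀ v, v ∈ L) ∧ (∀ v, v ∈ K) ∧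
      L.head? = some 0 ∧ K.head? = some 0 ∧ L.filter c = K.filter c ∧
      L.filter (fun v => !c v) = K.filter (fun v => !c v) ∧
      (L.filter c).length ≤ (n + 1) / 2 + 1 ∧
      (L.filter (fun v => !c v)).length ≤ (n + 1) / 2 ∧ c 0 = true ∧
      (∀ v, μP v ≠ v → AdjIn L v (μP v)) ∧ (∀ v, μD v ≠ v → AdjIn K v (μD v)) := by
  have hlen : ∀ {β : Type} [Fintype β] (L : List β), L.Nodup → (∀ v, v ∈ L) →
      L.length = Fintype.card β := by
    intro β _ L h1 h2
    classical
    rw [← List.toFinset_card_of_nodup h1, ← Finset.card_univ]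
    congr 1
    ext v; simp [h2]
  by_cases hE : Even (n + 1)
  · obtain ⟨c, L, K, h1, h2, h3, h4, h5, h6, h7, h8, h9, -, hc, h10, h11⟩ :=
      pairs_to_fun (z := fun _ => false) (o := (0 : Fin (n + 1))) (by simp) rfl μP μD hDinv
        (hDperf hE) hPinv (hPperf hE)
    have hl := len_split L c
    rw [hlen L h1 h3, Fintype.card_fin] at hl
    simp only [Bool.not_false, Bool.and_true] at h8
    exact ⟨c, L, K, h1, h2, h3, h4, h5, h6, h7, h8, by omega, by omega, hc,
      fun v _ => h10 v, fun v _ => h11 v⟩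
  · obtain ⟨mP, hmP, huP⟩ := hPnear hE
    obtain ⟨mD, hmD, huD⟩ := hDnear hE
    obtain ⟨c, L, K, h1, h2, h3, h4, h5, h6, h7, h8, h9, hzc, hc, h10, h11⟩ :=
      pairs_to_fun (z := fun v : Option (Fin (n + 1)) => v.isNone) (o := some (0 : Fin (n + 1)))
        (by rintro (_ | u) (_ | v) <;> simp) rfl (extInv μP mP) (extInv μD mD)
        (extInv_inv _ _ hDinv hmD) (extInv_ne _ _ huD) (extInv_inv _ _ hPinv hmP)
        (extInv_ne _ _ huP)
    have hl := len_split L c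
    rw [hlen L h1 h3, Fintype.card_option, Fintype.card_fin] at hl
    have hnone : c none = false := hzc none rfl
    have hfT : ∀ Q : List (Option (Fin (n + 1))), (Q.filterMap id).filter (fun v => c (some v)) =
        (Q.filter c).filterMap id := by
      intro Q
      induction Q with
      | nil => simp
      | cons a l ih =>
        cases a with
        | none => simpa [hnone] using ih
        | some a => cases h : c (some a) <;> simpa [h] using ih
    have hfF : ∀ Q : List (Option (Fin (n + 1))),
        (Q.filterMap id).filter (fun v => !c (some v)) =
        (Q.filter (fun v => !c v && !v.isNone)).filterMap id := by
      intro Q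
      induction Q with
      | nil => simp
      | cons a l ih =>
        cases a with
        | none => simpa [hnone] using ih
        | some a => cases h : c (some a) <;> simpa [h] using ih
    have hnd : ∀ Q : List (Option (Fin (n + 1))), Q.Nodup → (Q.filterMap id).Nodup := by
      intro Q hQ
      refine List.Nodup.filterMap ?_ hQ
      intro a a' b hb hb'
      simp at hb hb'
      rw [hb, hb']
    have hmem : ∀ Q : List (Option (Fin (n + 1))), (∀ v, v ∈ Q) → ∀ v, v ∈ Q.filterMap id := by
      intro Q hQ v
      simp [hQ]
    have hhead : ∀ Q : List (Option (Fin (n + 1))), Q.head? = some (some 0) →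
        (Q.filterMap id).head? = some 0 := by
      intro Q hQ
      cases Q with
      | nil => simp at hQ
      | cons a l => simp at hQ; simp [hQ]
    have hlT : ((L.filter c).filterMap id).length = (L.filter c).length := by
      refine List.reduceOption_length_eq_iff.2 ?_
      rintro (_ | v) hv
      · simp [hnone] at hv
      · rfl
    have hl' := len_split (L.filterMap id) (fun v => c (some v))
    rw [hlen _ (hnd L h1) (hmem L h3), Fintype.card_fin, hfT, hlT] at hl'
    beta_reduce at hl'
    have hadj : ∀ (μ : Equiv.Perm (Fin (n + 1))) (m : Fin (n + 1)) (_ : μ m = m)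
        (Q : List (Option (Fin (n + 1)))) (_ : ∀ v, AdjIn Q v (extInv μ m v)) (v : Fin (n + 1))
        (_ : μ v ≠ v), AdjIn (Q.filterMap id) v (μ v) := by
      intro μ m hm Q hQ v hv
      have hvm : v ≠ m := by rintro rfl; exact hv hm
      have := hQ (some v)
      simp only [extInv, hvm, if_false] at this
      rcases this with h | h
      · left; simpa using h.filterMap id
      · right; simpa using h.filterMap id
    refine ⟨fun v => c (some v), L.filterMap id, K.filterMap id, hnd L h1, hnd K h2, hmem L h3,
      hmem K h4, hhead L h5, hhead K h6, ?_, ?_, ?_, ?_, hc, hadj μP mP hmP L h10,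
      hadj μD mD hmD K h11⟩
    · rw [hfT, hfT, h7]
    · rw [hfF, hfF, h8]
    · rw [hfT, hlT]; omega
    · beta_reduce; omega

theorem tourSeq_zero {n : ℕ} (σ : Equiv.Perm (Fin n)) : tourSeq σ 0 = 0 := by simp [tourSeq]

theorem tourSeq_succ {n : ℕ} (σ : Equiv.Perm (Fin n)) (i : Fin n) :
    tourSeq σ i.succ = (σ i).succ := by simp [tourSeq]

theorem to_tour {n : ℕ} (L : List (Fin (n + 1))) (h1 : L.Nodup) (h2 : ∀ v, v ∈ L)
    (h3 : L.head? = some 0) : ∃ σ : Equiv.Perm (Fin n), L = List.ofFn (tourSeq σ) := by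
  have hl : L.length = n + 1 := by
    rw [← List.toFinset_card_of_nodup h1]
    have : L.toFinset = Finset.univ := by ext v; simp [h2]
    simp [this]
  have h0 : L[0] = 0 := by
    cases L with
    | nil => simp at hl
    | cons a l => simpa using h3
  let g : Fin n → Fin (n + 1) := fun i => L[(i : ℕ) + 1]
  have hg : ∀ i, g i ≠ 0 := by
    intro i h
    have : L[(i : ℕ) + 1] = L[0] := by rw [h0]; exact h
    rw [h1.getElem_inj_iff] at this
    omega
  have hinj : Function.Injective (fun i => (g i).pred (hg i)) := by
    intro i j h
    have h := Fin.pred_inj.1 h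
    have := (h1.getElem_inj_iff).1 h
    ext; omega
  refine ⟨Equiv.ofBijective _ (Finite.injective_iff_bijective.1 hinj), ?_⟩
  apply List.ext_getElem
  · simp [hl]
  · intro i hi hi'
    rw [List.getElem_ofFn]
    rcases i with _ | i
    · rw [h0]
      exact (tourSeq_zero _).symm
    · have := tourSeq_succ (Equiv.ofBijective _ (Finite.injective_iff_bijective.1 hinj))
        ⟨i, by omega⟩
      simp only [Fin.succ_mk] at this
      rw [this]
      simp [g]

theorem infix_tour {n : ℕ} (σ : Equiv.Perm (Fin n)) (u v : Fin (n + 1))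
    (h : [u, v] <:+: List.ofFn (tourSeq σ)) : ∃ q, tourSeq σ q = u ∧ tourSeq σ (q + 1) = v := by
  obtain ⟨k, hk, h⟩ := List.infix_iff_getElem?.1 h
  simp at hk
  have ha := h 0 (by simp)
  have hb := h 1 (by simp)
  rw [List.getElem?_eq_getElem (by simp; omega)] at ha hb
  simp only [List.getElem_ofFn, Option.some.injEq] at ha hb
  refine ⟨⟨k, by omega⟩, ?_, ?_⟩
  · simpa using ha
  · have : (⟨k, by omega⟩ : Fin (n + 1)) + 1 = ⟨1 + k, by omega⟩ := by
      ext
      rw [Fin.val_add_one_of_lt]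
      · simp [add_comm]
      · rw [Fin.lt_def]; simp; omega
    rw [this]
    simpa using hb

theorem matching_of_adj {n : ℕ} (σ : Equiv.Perm (Fin n)) (μ : Equiv.Perm (Fin (n + 1)))
    (h : ∀ v, μ v ≠ v → AdjIn (List.ofFn (tourSeq σ)) v (μ v)) : MatchingInTour μ σ := by
  intro v hv
  rcases h v hv with h | h
  · obtain ⟨q, hq⟩ := infix_tour σ _ _ h
    exact ⟨q, Or.inl hq⟩
  · obtain ⟨q, hq⟩ := infix_tour σ _ _ h
    exact ⟨q, Or.inr hq⟩

theorem tourSeq_rev {n : ℕ} (σ : Equiv.Perm (Fin n)) (q : Fin (n + 1)) :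
    tourSeq (revTour σ) (-q) = tourSeq σ q := by
  induction q using Fin.cases with
  | zero => simp [tourSeq_zero]
  | succ i =>
    have : -i.succ = (Fin.rev i).succ := by
      ext
      rw [Fin.val_neg]
      simp [Fin.val_rev]
      omega
    rw [this, tourSeq_succ, tourSeq_succ]
    simp [revTour]

theorem matching_rev {n : ℕ} (σ : Equiv.Perm (Fin n)) (μ : Equiv.Perm (Fin (n + 1)))
    (h : MatchingInTour μ σ) : MatchingInTour μ (revTour σ) := by
  intro v hv
  obtain ⟨q, hq⟩ := h v hv
  refine ⟨-(q + 1), ?_⟩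
  have : -(q + 1) + 1 = -q := by abel
  rw [this, tourSeq_rev, tourSeq_rev]
  tauto

theorem before_rev {n : ℕ} (σ : Equiv.Perm (Fin n)) (i j : Fin n) :
    visitsBefore (revTour σ) j i ↔ visitsBefore σ i j := by
  simp [visitsBefore, revTour]

theorem before_of_sublist {n : ℕ} (σ : Equiv.Perm (Fin n)) (i j : Fin n)
    (h : [i.succ, j.succ].Sublist (List.ofFn (tourSeq σ))) : visitsBefore σ i j := by
  have hp : (List.ofFn (tourSeq σ)).Pairwise
      (fun a b => ∀ i j : Fin n, a = i.succ → b = j.succ → visitsBefore σ i j) := by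
    rw [List.pairwise_ofFn]
    intro a b hab i j ha hb
    induction a using Fin.cases with
    | zero => rw [tourSeq_zero] at ha; exact absurd ha.symm (Fin.succ_ne_zero _)
    | succ a =>
      induction b using Fin.cases with
      | zero => simp at hab
      | succ b =>
        rw [tourSeq_succ, Fin.succ_inj] at ha hb
        subst ha hb
        simpa [visitsBefore] using hab
  exact List.pairwise_iff_forall_sublist.1 hp h i j rfl rfl

theorem pair_sublist {α : Type*} {L : List α} {a b : α} (hab : a ≠ b) (ha : a ∈ L) (hb : b ∈ L) :
    [a, b].Sublist L ∨ [b, a].Sublist L := by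
  induction L with
  | nil => simp at ha
  | cons x l ih =>
    rcases List.mem_cons.1 ha with rfl | ha'
    · rcases List.mem_cons.1 hb with rfl | hb'
      · exact absurd rfl hab
      · exact Or.inl ((List.singleton_sublist.2 hb').cons_cons _)
    · rcases List.mem_cons.1 hb with rfl | hb'
      · exact Or.inr ((List.singleton_sublist.2 ha').cons_cons _)
      · rcases ih ha' hb' with h | h
        · exact Or.inl (h.cons _)
        · exact Or.inr (h.cons _)

theorem before_congr {n : ℕ} (σ τ : Equiv.Perm (Fin n)) (c : Fin (n + 1) → Bool)
    (h : (List.ofFn (tourSeq σ)).filter c = (List.ofFn (tourSeq τ)).filter c)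
    (hm : ∀ v, v ∈ List.ofFn (tourSeq σ)) (i j : Fin n) (hij : i ≠ j)
    (hi : c i.succ = true) (hj : c j.succ = true) :
    visitsBefore σ i j ↔ visitsBefore τ i j := by
  have key : ∀ i j : Fin n, [i.succ, j.succ].Sublist ((List.ofFn (tourSeq σ)).filter c) →
      visitsBefore σ i j ∧ visitsBefore τ i j := by
    intro i j hs
    refine ⟨before_of_sublist σ i j (hs.trans List.filter_sublist), ?_⟩
    rw [h] at hs
    exact before_of_sublist τ i j (hs.trans List.filter_sublist)
  have hne : i.succ ≠ j.succ := fun e => hij (Fin.succ_inj.1 e)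
  rcases pair_sublist hne (L := (List.ofFn (tourSeq σ)).filter c) (by simp only [List.mem_filter]; exact ⟨hm _, hi⟩)
    (by simp only [List.mem_filter]; exact ⟨hm _, hj⟩) with hs | hs
  · have := key _ _ hs
    exact ⟨fun _ => this.2, fun _ => this.1⟩
  · have := key _ _ hs
    exact ⟨fun h' => absurd (lt_trans h' this.1) (lt_irrefl _),
      fun h' => absurd (lt_trans h' this.2) (lt_irrefl _)⟩

theorem card_le_filter {n : ℕ} (L : List (Fin (n + 1))) (hm : ∀ v, v ∈ L)
    (c : Fin (n + 1) → Bool) :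
    (Finset.univ.filter fun i : Fin n => c i.succ = true).card + (if c 0 then 1 else 0)
      ≤ (L.filter c).length := by
  have h1 : (Finset.univ.filter fun v : Fin (n + 1) => c v = true).card ≤ (L.filter c).length := by
    refine le_trans (Finset.card_le_card ?_) (List.toFinset_card_le _)
    intro v hv
    simpa [hm] using hv
  rw [Fin.card_filter_univ_succ] at h1
  split_ifs at h1 ⊢ <;> simpa using h1

/-- given matchings `M_P`, `M_D` on `V = {0,...,n}` (perfect if `|V|` is
even, near-perfect otherwise), there exist a 2-row loading plan `f` with fibers of size at
most `⌈n/2⌉` and a pair of tours `(T_P, T_D)` feasible with respect to `f` such that every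
edge of `M_P` is an edge of `T_P` and every edge of `M_D` is an edge of `T_D`. -/
theorem stmt12 (n : ℕ) (hn : 2 ≤ n)
    (μP μD : Equiv.Perm (Fin (n + 1)))
    (hPinv : IsInvolution μP) (hDinv : IsInvolution μD)
    (hPperf : Even (n + 1) → ∀ v, μP v ≠ v)
    (hPnear : ¬ Even (n + 1) → ∃! v, μP v = v)
    (hDperf : Even (n + 1) → ∀ v, μD v ≠ v)
    (hDnear : ¬ Even (n + 1) → ∃! v, μD v = v) :
    ∃ (f : Fin n → Fin 2) (TP TD : Equiv.Perm (Fin n)),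
      IsLoadingPlan 2 ((n + 1) / 2) f ∧ FeasibleFor f TP TD ∧
      MatchingInTour μP TP ∧ MatchingInTour μD TD := by
  obtain ⟨c, L, K, h1, h2, h3, h4, h5, h6, h7, h8, h9, h10, hc, h11, h12⟩ :=
    main_lists n μP μD hPinv hDinv hPperf hPnear hDperf hDnear
  obtain ⟨σ, rfl⟩ := to_tour L h1 h3 h5
  obtain ⟨τ, rfl⟩ := to_tour K h2 h4 h6
  refine ⟨fun i => if c i.succ = true then 0 else 1, σ, revTour τ, ?_, ?_,
    matching_of_adj σ μP h11, matching_rev τ μD (matching_of_adj τ μD h12)⟩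
  · intro r
    have hT := card_le_filter _ h3 c
    have hF := card_le_filter _ h3 (fun v => !c v)
    simp only [hc, if_true] at hT
    have e0 : (Finset.univ.filter fun i : Fin n =>
        (if c i.succ = true then (0 : Fin 2) else 1) = 0) =
        Finset.univ.filter fun i : Fin n => c i.succ = true := by
      ext i; cases h : c i.succ <;> simp [h]
    have e1 : (Finset.univ.filter fun i : Fin n =>
        (if c i.succ = true then (0 : Fin 2) else 1) = 1) =
        Finset.univ.filter fun i : Fin n => (!c i.succ) = true := by
      ext i; cases h : c i.succ <;> simp [h]
    rcases Fin.exists_fin_two.1 ⟨r, rfl⟩ with h | h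
    · subst h
      exact (congrArg Finset.card e0).le.trans (by omega)
    · subst h
      exact (congrArg Finset.card e1).le.trans (by omega)
  · intro i j hij hf
    rw [before_rev]
    cases hi : c i.succ <;> cases hj : c j.succ <;> simp [hi, hj] at hf
    · exact before_congr σ τ (fun v => !c v) h8 h3 i j hij (by simp [hi]) (by simp [hj])
    · exact before_congr σ τ c h7 h3 i j hij hi hj
end
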